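/- Let θ ∈ ℝ, ω ∈ ℝ^d with {k·ω mod 1 : k ∈ ℤ^d} dense in ℝ/ℤ, and θ₀ ∈ ℂ. Define Q₀⁺ = {k ∈ ℤ^d : ‖θ + k·ω + θ₀‖ < δ}, Q₀⁻ = {k : ‖θ + k·ω - θ₀‖ < δ}, and the enlarged sets Q̃₀^± with δ replaced by δ' ≥ δ. Then dist(Q̃₀⁻, Q₀⁺) = dist(Q̃₀⁺, Q₀⁻), where dist is the infimum of ‖i - j‖ over i in one set and j in the other. -/

import Mathlib

open scoped ENNReal

noncomputable section

/-- The norm `‖z‖ = √(b² + dist(a,ℤ)²)` for `z = a + ib ∈ ℂ`. -/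
def znorm (z : ℂ) : ℝ := Real.sqrt (z.im ^ 2 + |z.re - (round z.re : ℝ)| ^ 2)

/-- Distance between two subsets of `ℤ^d` with respect to the sup norm
(`⊤` for empty sets). -/
def setDist {d : ℕ} (A B : Set (Fin d → ℤ)) : ℝ≥0∞ :=
  ⨅ (i : A) (j : B), ((Finset.univ.sup fun t => ((i : Fin d → ℤ) t -
    (j : Fin d → ℤ) t).natAbs : ℕ) : ℝ≥0∞)

theorem znorm_eq_norm (z : ℂ) : znorm z = ‖z - ((round z.re : ℝ) : ℂ)‖ := by
  rw [znorm, Complex.norm_eq_sqrt_sq_add_sq]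
  congr 1
  simp only [Complex.sub_re, Complex.sub_im, Complex.ofReal_re, Complex.ofReal_im, sq_abs, sub_zero]
  ring

theorem znorm_le_norm (z : ℂ) (n : ℤ) : znorm z ≤ ‖z - ((n : ℝ) : ℂ)‖ := by
  rw [znorm, Complex.norm_eq_sqrt_sq_add_sq]
  apply Real.sqrt_le_sqrt
  simp only [Complex.sub_re, Complex.sub_im, Complex.ofReal_re, Complex.ofReal_im, sub_zero]
  have h := round_le z.re n
  have h2 : |z.re - (round z.re : ℝ)| ^ 2 ≤ |z.re - (n : ℝ)| ^ 2 := by gcongr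
  rw [sq_abs (z.re - (n : ℝ))] at h2
  linarith

theorem znorm_real_sub_le (s : ℝ) (m : ℤ) (x : ℂ) :
    znorm ((s : ℂ) - x) ≤ |s - m| + znorm x := by
  refine (znorm_le_norm _ (m - round x.re)).trans ?_
  rw [znorm_eq_norm x]
  have e : (s : ℂ) - x - (((m - round x.re : ℤ) : ℝ) : ℂ)
      = ((s - m : ℝ) : ℂ) - (x - ((round x.re : ℝ) : ℂ)) := by
    push_cast; ring
  rw [e]
  refine (norm_sub_le _ _).trans ?_
  rw [Complex.norm_real, Real.norm_eq_abs]

theorem exists_close {d : ℕ} (θ : ℝ) (ω : Fin d → ℝ)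
    (hdense : Dense (Set.range fun k : Fin d → ℤ =>
      ((∑ i, (k i : ℝ) * ω i : ℝ) : AddCircle (1 : ℝ)))) (ε : ℝ) (hε : 0 < ε) :
    ∃ (k : Fin d → ℤ) (m : ℤ), |2 * θ + (∑ i, (k i : ℝ) * ω i) - m| < ε := by
  obtain ⟨y, ⟨k, rfl⟩, hk⟩ := hdense.exists_dist_lt ((-(2 * θ) : ℝ) : AddCircle (1 : ℝ)) hε
  rw [dist_comm, dist_eq_norm, ← AddCircle.coe_sub, AddCircle.norm_eq] at hk
  generalize round (_ : ℝ) = m at hk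
  refine ⟨k, m, lt_of_eq_of_lt ?_ hk⟩
  congr 1
  ring

theorem setDist_half {d : ℕ} (θ : ℝ) (ω : Fin d → ℝ) (θ₀ : ℂ) (δ δ' : ℝ)
    (hdense : Dense (Set.range fun k : Fin d → ℤ =>
      ((∑ i, (k i : ℝ) * ω i : ℝ) : AddCircle (1 : ℝ)))) :
    setDist
        {k : Fin d → ℤ | znorm ((θ : ℂ) + (∑ i, (k i : ℝ) * ω i : ℝ) + θ₀) < δ'}
        {k : Fin d → ℤ | znorm ((θ : ℂ) + (∑ i, (k i : ℝ) * ω i : ℝ) - θ₀) < δ} ≤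
      setDist
        {k : Fin d → ℤ | znorm ((θ : ℂ) + (∑ i, (k i : ℝ) * ω i : ℝ) - θ₀) < δ'}
        {k : Fin d → ℤ | znorm ((θ : ℂ) + (∑ i, (k i : ℝ) * ω i : ℝ) + θ₀) < δ} := by
  refine le_iInf fun i => le_iInf fun j => ?_
  obtain ⟨i, hi⟩ := i
  obtain ⟨j, hj⟩ := j
  rw [Set.mem_ofPred_eq] at hi hj
  obtain ⟨k, m, hk⟩ := exists_close θ ω hdense _ (lt_min (sub_pos.2 hi) (sub_pos.2 hj))
  obtain ⟨h1, h2⟩ := lt_min_iff.1 hk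
  have hsum : ∀ l : Fin d → ℤ, (∑ t, (((k - l) t : ℤ) : ℝ) * ω t)
      = (∑ t, (k t : ℝ) * ω t) - ∑ t, (l t : ℝ) * ω t := by
    intro l
    rw [← Finset.sum_sub_distrib]
    refine Finset.sum_congr rfl fun t _ => ?_
    rw [Pi.sub_apply]
    push_cast
    ring
  refine (iInf_le_of_le ⟨k - i, ?_⟩ (iInf_le_of_le ⟨k - j, ?_⟩ ?_))
  · rw [Set.mem_ofPred_eq, hsum]
    have := znorm_real_sub_le (2 * θ + ∑ t, (k t : ℝ) * ω t) m
      ((θ : ℂ) + (∑ t, (i t : ℝ) * ω t : ℝ) - θ₀)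
    refine lt_of_eq_of_lt ?_ (this.trans_lt (by linarith))
    congr 1
    push_cast
    ring
  · rw [Set.mem_ofPred_eq, hsum]
    have := znorm_real_sub_le (2 * θ + ∑ t, (k t : ℝ) * ω t) m
      ((θ : ℂ) + (∑ t, (j t : ℝ) * ω t : ℝ) + θ₀)
    refine lt_of_eq_of_lt ?_ (this.trans_lt (by linarith))
    congr 1
    push_cast
    ring
  · apply le_of_eq
    congr 2
    funext t
    simp only [Pi.sub_apply]
    omega

/-- Symmetry of resonance distances (Remark 3.1): with
`Q₀^± = {k : ‖θ + k·ω ± θ₀‖ < δ}` and `Q̃₀^±` defined with `δ' ≥ δ`, assuming the orbit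
`{k·ω}` is dense in `ℝ/ℤ`, one has `dist(Q̃₀⁻, Q₀⁺) = dist(Q̃₀⁺, Q₀⁻)`. -/
theorem resonance_set_dist_symm
    {d : ℕ} (θ : ℝ) (ω : Fin d → ℝ) (θ₀ : ℂ) (δ δ' : ℝ)
    (hδ : 0 < δ) (hδ' : δ ≤ δ')
    (hdense : Dense (Set.range fun k : Fin d → ℤ =>
      ((∑ i, (k i : ℝ) * ω i : ℝ) : AddCircle (1 : ℝ)))) :
    setDist
        {k : Fin d → ℤ | znorm ((θ : ℂ) + (∑ i, (k i : ℝ) * ω i : ℝ) - θ₀) < δ'}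
        {k : Fin d → ℤ | znorm ((θ : ℂ) + (∑ i, (k i : ℝ) * ω i : ℝ) + θ₀) < δ} =
      setDist
        {k : Fin d → ℤ | znorm ((θ : ℂ) + (∑ i, (k i : ℝ) * ω i : ℝ) + θ₀) < δ'}
        {k : Fin d → ℤ | znorm ((θ : ℂ) + (∑ i, (k i : ℝ) * ω i : ℝ) - θ₀) < δ} := by
  apply le_antisymm
  · have h := setDist_half θ ω (-θ₀) δ δ' hdense
    simpa only [sub_neg_eq_add, ← sub_eq_add_neg] using h
  · exact setDist_half θ ω θ₀ δ δ' hdense
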